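/- Let M be a positive integer and f : ℍ → ℂ a function invariant under Γ₀(M) in weight 0 (i.e. f(γ·τ) = f(τ) for all γ ∈ Γ₀(M)). Let p be a prime and d a positive integer with p ∣ d, and assume p exactly divides M·d (i.e. p ∤ Md/p). Define (g∣B_m)(τ) = g(mτ). Then for any Atkin-Lehner matrix W_p for p at level Md one has (f∣B_d)(W_p·τ) = (f∣B_{d/p})(τ) for all τ ∈ ℍ, i.e. f∣B_d∣W_p = f∣B_{d/p} in weight 0. -/

import Mathlib

noncomputable section

open Complex Matrix Finset UpperHalfPlane

/-- Möbius action of a real `2×2` matrix on the upper half-plane (this is the genuine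
Möbius action `τ ↦ (aτ+b)/(cτ+d)` whenever the matrix has positive determinant). -/
def moebius (g : Matrix (Fin 2) (Fin 2) ℝ) (τ : UpperHalfPlane) : UpperHalfPlane :=
  if h : 0 < ((((g 0 0 : ℝ) : ℂ) * (τ : ℂ) + ((g 0 1 : ℝ) : ℂ)) /
      (((g 1 0 : ℝ) : ℂ) * (τ : ℂ) + ((g 1 1 : ℝ) : ℂ))).im then
    UpperHalfPlane.mk _ h else τ

/-- The weight-`k` slash action of a real `2×2` matrix, normalized with `det ^ (k/2)`. -/
def slash (k : ℤ) (g : Matrix (Fin 2) (Fin 2) ℝ) (f : UpperHalfPlane → ℂ) :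
    UpperHalfPlane → ℂ :=
  fun τ => ((g.det : ℝ) : ℂ) ^ ((k : ℂ) / 2) *
    (((g 1 0 : ℝ) : ℂ) * (τ : ℂ) + ((g 1 1 : ℝ) : ℂ)) ^ (-k) * f (moebius g τ)

/-- `g` is (the image in `SL₂(ℝ)` of) an integer matrix of determinant `1` whose
lower-left entry is divisible by `N`, i.e. an element of `Γ₀(N)`. -/
def MemGamma0 (N : ℕ) (g : Matrix (Fin 2) (Fin 2) ℝ) : Prop :=
  (∃ a b c d : ℤ, g = !![(a : ℝ), (b : ℝ); (c : ℝ), (d : ℝ)] ∧ (N : ℤ) ∣ c) ∧ g.det = 1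

/-- `f` transforms like a modular form of weight `k` for `Γ₀(N)`. -/
def TransformsLike (N : ℕ) (k : ℤ) (f : UpperHalfPlane → ℂ) : Prop :=
  ∀ g, MemGamma0 N g → slash k g f = f

/-- An Atkin-Lehner matrix for the exact divisor `Q` at level `N`:
`W_Q = (1/√Q)·(Qx, y; Nz, Qt)` with integer entries and determinant `1`. -/
def IsAtkinLehner (N Q : ℕ) (W : Matrix (Fin 2) (Fin 2) ℝ) : Prop :=
  (∃ x y z t : ℤ,
      W = (Real.sqrt Q)⁻¹ • !![(Q : ℝ) * x, (y : ℝ); (N : ℝ) * z, (Q : ℝ) * t]) ∧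
    W.det = 1

/-- The matrix `B_m = (1/√m)·(m, 0; 0, 1)`. -/
def Bmat (m : ℕ) : Matrix (Fin 2) (Fin 2) ℝ :=
  (Real.sqrt m)⁻¹ • !![(m : ℝ), 0; 0, 1]

/-- The `m`-th Hecke operator of weight `k` and level `N`:
`(f∣T_m)(τ) = m^{k/2−1} Σ_{ad = m, gcd(a,N)=1} Σ_{b=0}^{d−1} (f∣ₖ(a, b; 0, d))(τ)`. -/
def hecke (N : ℕ) (k : ℤ) (m : ℕ) (f : UpperHalfPlane → ℂ) : UpperHalfPlane → ℂ :=
  fun τ => (m : ℂ) ^ ((k : ℂ) / 2 - 1) *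
    ∑ a ∈ m.divisors, if Nat.gcd a N = 1 then
      ∑ b ∈ Finset.range (m / a), slash k !![(a : ℝ), (b : ℝ); 0, ((m / a : ℕ) : ℝ)] f τ
    else 0

/-- The weight-`0` operator `U_m`: `(f∣U_m)(τ) = (1/m) Σ_{j=0}^{m−1} f((τ+j)/m)`. -/
def U0 (m : ℕ) (f : UpperHalfPlane → ℂ) : UpperHalfPlane → ℂ :=
  fun τ => (1 / (m : ℂ)) * ∑ j ∈ Finset.range m, f (moebius !![1, (j : ℝ); 0, (m : ℝ)] τ)

/-- The weight-`0` operator `B_m`: `(f∣B_m)(τ) = f(mτ)`. -/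
def B0 (m : ℕ) (f : UpperHalfPlane → ℂ) : UpperHalfPlane → ℂ :=
  fun τ => f (moebius !![(m : ℝ), 0; 0, 1] τ)

/-- The weight-`0` action of a matrix: `(f∣W)(τ) = f(W·τ)`. -/
def W0 (W : Matrix (Fin 2) (Fin 2) ℝ) (f : UpperHalfPlane → ℂ) : UpperHalfPlane → ℂ :=
  fun τ => f (moebius W τ)

/-- `f` is invariant under `Γ₀(N)` in weight `0`. -/
def Inv0 (N : ℕ) (f : UpperHalfPlane → ℂ) : Prop :=
  ∀ g, MemGamma0 N g → ∀ τ, f (moebius g τ) = f τ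

/-- The denominator of a Möbius transformation of nonzero determinant does not vanish on `ℍ`. -/
lemma moebius_denom_ne_zero {g : Matrix (Fin 2) (Fin 2) ℝ} (hg : g.det ≠ 0)
    (τ : UpperHalfPlane) :
    ((g 1 0 : ℝ) : ℂ) * (τ : ℂ) + ((g 1 1 : ℝ) : ℂ) ≠ 0 := by
  intro h
  have him := congrArg Complex.im h
  have hre := congrArg Complex.re h
  simp [τ.im_ne_zero] at him
  simp [him] at hre
  exact hg (by simp [Matrix.det_fin_two, him, hre])

/-- For a matrix of positive determinant, `moebius` is the linear fractional transformation. -/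
lemma coe_moebius {g : Matrix (Fin 2) (Fin 2) ℝ} (hg : 0 < g.det) (τ : UpperHalfPlane) :
    (moebius g τ : ℂ) = (((g 0 0 : ℝ) : ℂ) * (τ : ℂ) + ((g 0 1 : ℝ) : ℂ)) /
      (((g 1 0 : ℝ) : ℂ) * (τ : ℂ) + ((g 1 1 : ℝ) : ℂ)) := by
  have hden := Complex.normSq_pos.2 (moebius_denom_ne_zero hg.ne' τ)
  have him : 0 < ((((g 0 0 : ℝ) : ℂ) * (τ : ℂ) + ((g 0 1 : ℝ) : ℂ)) /
      (((g 1 0 : ℝ) : ℂ) * (τ : ℂ) + ((g 1 1 : ℝ) : ℂ))).im := by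
    rw [Complex.div_im, ← sub_div]
    refine div_pos ?_ hden
    have h := mul_pos hg τ.im_pos
    rw [Matrix.det_fin_two] at h
    simp
    linarith
  rw [moebius, dif_pos him]

/-- `moebius` is a left action on matrices of positive determinant. -/
lemma moebius_mul {A B : Matrix (Fin 2) (Fin 2) ℝ} (hA : 0 < A.det) (hB : 0 < B.det)
    (τ : UpperHalfPlane) : moebius (A * B) τ = moebius A (moebius B τ) := by
  have hAB : 0 < (A * B).det := by rw [Matrix.det_mul]; exact mul_pos hA hB
  have hdB := moebius_denom_ne_zero hB.ne' τ
  have hdAB := moebius_denom_ne_zero hAB.ne' τ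
  have hdA := moebius_denom_ne_zero hA.ne' (moebius B τ)
  apply UpperHalfPlane.ext
  rw [coe_moebius hB] at hdA
  rw [coe_moebius hAB, coe_moebius hA, coe_moebius hB, div_eq_div_iff hdAB hdA]
  simp only [Matrix.mul_apply, Fin.sum_univ_two]
  push_cast
  field_simp
  ring

/-- Scaling a matrix by a nonzero real does not change its Möbius action. -/
lemma moebius_smul {r : ℝ} (hr : r ≠ 0) (g : Matrix (Fin 2) (Fin 2) ℝ)
    (τ : UpperHalfPlane) : moebius (r • g) τ = moebius g τ := by
  have hr' : (r : ℂ) ≠ 0 := by exact_mod_cast hr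
  have h : ((((r • g) 0 0 : ℝ) : ℂ) * (τ : ℂ) + (((r • g) 0 1 : ℝ) : ℂ)) /
      ((((r • g) 1 0 : ℝ) : ℂ) * (τ : ℂ) + (((r • g) 1 1 : ℝ) : ℂ)) =
      (((g 0 0 : ℝ) : ℂ) * (τ : ℂ) + ((g 0 1 : ℝ) : ℂ)) /
      (((g 1 0 : ℝ) : ℂ) * (τ : ℂ) + ((g 1 1 : ℝ) : ℂ)) := by
    simp only [Matrix.smul_apply, smul_eq_mul, Complex.ofReal_mul, mul_assoc, ← mul_add]
    exact mul_div_mul_left _ _ hr'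
  simp only [moebius, h]

/-- If `f` is weight-`0` invariant under `Γ₀(M)`, `p` is prime, `p ∣ d`,
and `p` exactly divides `M·d`, then for any Atkin-Lehner matrix `W_p` for `p` at level
`M·d` one has `(f∣B_d)(W_p·τ) = (f∣B_{d/p})(τ)` for all `τ ∈ ℍ`. -/
theorem Bd_atkinLehner_eq_Bdp (M : ℕ) (hM : 0 < M) (f : UpperHalfPlane → ℂ)
    (hf : Inv0 M f) (p : ℕ) (hp : p.Prime) (d : ℕ) (hd : 0 < d) (hpd : p ∣ d)
    (hpe : ¬ p ∣ M * d / p)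
    (W : Matrix (Fin 2) (Fin 2) ℝ) (hW : IsAtkinLehner (M * d) p W) :
    ∀ τ, B0 d f (moebius W τ) = B0 (d / p) f τ := by
  obtain ⟨⟨x, y, z, t, rfl⟩, hdet⟩ := hW
  obtain ⟨e, rfl⟩ := hpd
  intro τ
  have hp0 : (p : ℝ) ≠ 0 := by exact_mod_cast hp.ne_zero
  have he : (0 : ℝ) < e := by exact_mod_cast Nat.pos_of_mul_pos_left hd
  have hs : (Real.sqrt p)⁻¹ ≠ 0 := by
    simpa using hp.ne_zero
  have hs2 : (Real.sqrt p)⁻¹ ^ 2 * p = 1 := by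
    rw [inv_pow, Real.sq_sqrt p.cast_nonneg, inv_mul_cancel₀ hp0]
  set s := (Real.sqrt p)⁻¹
  set γ : Matrix (Fin 2) (Fin 2) ℝ :=
    !![((p * x : ℤ) : ℝ), ((e * y : ℤ) : ℝ); ((M * z : ℤ) : ℝ), (t : ℝ)] with hγ
  have hγdet : γ.det = 1 := by
    rw [← hdet, hγ, Matrix.det_fin_two, Matrix.det_fin_two]
    simp
    linear_combination (-(p * x * t - M * e * y * z) : ℝ) * hs2
  have hBd : 0 < (!![((p * e : ℕ) : ℝ), 0; 0, 1] : Matrix (Fin 2) (Fin 2) ℝ).det := by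
    rw [Matrix.det_fin_two_of]
    simpa using (by exact_mod_cast hd : (0 : ℝ) < p * e)
  have hBe : 0 < (!![(e : ℝ), 0; 0, 1] : Matrix (Fin 2) (Fin 2) ℝ).det := by
    simpa [Matrix.det_fin_two_of] using he
  have hmul : !![((p * e : ℕ) : ℝ), 0; 0, 1] *
      (s • !![(p : ℝ) * x, (y : ℝ); ((M * (p * e) : ℕ) : ℝ) * z, (p : ℝ) * t]) =
      (s * p) • (γ * !![(e : ℝ), 0; 0, 1]) := by
    ext i j
    fin_cases i <;> fin_cases j <;> simp [hγ, Matrix.mul_apply, Fin.sum_univ_two] <;> ring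
  rw [Nat.mul_div_cancel_left e hp.pos]
  unfold B0
  rw [← moebius_mul hBd (hdet ▸ one_pos), hmul, moebius_smul (mul_ne_zero hs hp0),
    moebius_mul (hγdet ▸ one_pos) hBe]
  exact hf γ ⟨⟨p * x, e * y, M * z, t, hγ, dvd_mul_right _ _⟩, hγdet⟩ _
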